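/- Total approximation error bound for an arbitrary belief state: under the hypotheses of the total approximation error theorem, define the projected estimator Ṽ^h_t(b) := V̂^h_t(Proj_B(b)) for b ∈ Δ_M. Then for every t = 0,…,H and every b ∈ Δ_M, |V*_t(b) − Ṽ^h_t(b)| ≤ δ_A·Σ_{s=t}^{H−1} K_s + δ_B·Σ_{s=t}^{H} L^h_s. -/

import Mathlib

open Finset ComplexOrder

/-- The belief simplex `Δ_M ⊆ ℝ^M`. -/
def simplex (M : ℕ) : Set (Fin M → ℝ) :=
  {b | (∀ i, 0 ≤ b i) ∧ ∑ i, b i = 1}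

/-- The real number `Re Tr(E ρ)`, the Born-rule likelihood value. -/
noncomputable def trRe {d : ℕ} (E ρ : Matrix (Fin d) (Fin d) ℂ) : ℝ :=
  ((E * ρ).trace).re

/-- Observation probability `ObsProb(o | b, a) = Σ_j b j · Tr(E_o^{(a)} ρ_j)`. -/
noncomputable def obsProb {d M : ℕ} {O A : Type}
    (E : A → O → Matrix (Fin d) (Fin d) ℂ)
    (ρ : Fin M → Matrix (Fin d) (Fin d) ℂ)
    (o : O) (b : Fin M → ℝ) (a : A) : ℝ :=
  ∑ j, b j * trRe (E a o) (ρ j)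

/-- Bayesian posterior `τ(b,a,o)(i) = b i · Tr(E_o^{(a)} ρ_i) / ObsProb(o|b,a)`
(junk value when `ObsProb(o|b,a) = 0`, which only ever appears multiplied by a zero
observation probability). -/
noncomputable def bayes {d M : ℕ} {O A : Type}
    (E : A → O → Matrix (Fin d) (Fin d) ℂ)
    (ρ : Fin M → Matrix (Fin d) (Fin d) ℂ)
    (b : Fin M → ℝ) (a : A) (o : O) : Fin M → ℝ :=
  fun i => b i * trRe (E a o) (ρ i) / obsProb E ρ o b a

/-- Stopping value `StopVal(b) = max_i b i`. -/
noncomputable def stopVal {M : ℕ} [NeZero M] (b : Fin M → ℝ) : ℝ :=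
  univ.sup' univ_nonempty b

/-- Continuation functional
`G(b,θ;W) = −c_meas + Σ_o ObsProb(o|b,θ) · W(τ(b,θ,o))`
(outcomes with `ObsProb(o|b,θ) = 0` contribute zero). -/
noncomputable def contG {d M : ℕ} {O Θ : Type} [Fintype O]
    (E : Θ → O → Matrix (Fin d) (Fin d) ℂ)
    (ρ : Fin M → Matrix (Fin d) (Fin d) ℂ)
    (c : ℝ) (b : Fin M → ℝ) (θ : Θ) (W : (Fin M → ℝ) → ℝ) : ℝ :=
  -c + ∑ o, obsProb E ρ o b θ * W (bayes E ρ b θ o)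

open scoped MatrixOrder Matrix.Norms.L2Operator in
lemma Matrix.PosSemidef.trace_mul_nonneg {n : Type*} [Fintype n] [DecidableEq n]
    {A B : Matrix n n ℂ} (hA : A.PosSemidef) (hB : B.PosSemidef) : 0 ≤ (A * B).trace := by
  obtain ⟨C, rfl⟩ := CStarAlgebra.nonneg_iff_eq_star_mul_self.mp hB.nonneg
  rw [← Matrix.mul_assoc, Matrix.trace_mul_comm, ← Matrix.mul_assoc]
  exact (hA.mul_mul_conjTranspose_same C).trace_nonneg

lemma trRe_nonneg {d : ℕ} {E ρ : Matrix (Fin d) (Fin d) ℂ}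
    (hE : E.PosSemidef) (hρ : ρ.PosSemidef) : 0 ≤ trRe E ρ :=
  (Complex.nonneg_iff.mp (hE.trace_mul_nonneg hρ)).1

lemma sum_trRe_eq_one {d : ℕ} {O : Type*} [Fintype O] {E : O → Matrix (Fin d) (Fin d) ℂ}
    {ρ : Matrix (Fin d) (Fin d) ℂ} (hE : ∑ o, E o = 1) (hρ : ρ.trace = 1) :
    ∑ o, trRe (E o) ρ = 1 := by
  simp only [trRe]
  rw [← Complex.re_sum, ← Matrix.trace_sum, ← Finset.sum_mul, hE, one_mul, hρ, Complex.one_re]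

section Belief

variable {d M : ℕ} {O A : Type} {E : A → O → Matrix (Fin d) (Fin d) ℂ}
  {ρ : Fin M → Matrix (Fin d) (Fin d) ℂ} {b : Fin M → ℝ} {a : A}

lemma obsProb_nonneg (hE : ∀ o, (E a o).PosSemidef) (hρ : ∀ i, (ρ i).PosSemidef)
    (hb : b ∈ simplex M) (o : O) : 0 ≤ obsProb E ρ o b a :=
  Finset.sum_nonneg fun j _ => mul_nonneg (hb.1 j) (trRe_nonneg (hE o) (hρ j))

lemma sum_obsProb [Fintype O] (hE : ∑ o, E a o = 1) (hρ : ∀ i, (ρ i).trace = 1)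
    (hb : b ∈ simplex M) : ∑ o, obsProb E ρ o b a = 1 := by
  simp only [obsProb]
  rw [Finset.sum_comm]
  simp only [← Finset.mul_sum, sum_trRe_eq_one hE (hρ _), mul_one]
  exact hb.2

lemma bayes_mem_simplex (hE : ∀ o, (E a o).PosSemidef) (hρ : ∀ i, (ρ i).PosSemidef)
    (hb : b ∈ simplex M) {o : O} (ho : 0 < obsProb E ρ o b a) :
    bayes E ρ b a o ∈ simplex M := by
  refine ⟨fun i => div_nonneg (mul_nonneg (hb.1 i) (trRe_nonneg (hE o) (hρ i))) ho.le, ?_⟩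
  simp only [bayes]
  rw [← Finset.sum_div]
  exact div_self ho.ne'

end Belief

lemma abs_sum_mul_sub_sum_mul_le {ι : Type*} [Fintype ι] {p u v : ι → ℝ} {ε : ℝ}
    (hp : ∀ i, 0 ≤ p i) (hsum : ∑ i, p i = 1) (h : ∀ i, 0 < p i → |u i - v i| ≤ ε) :
    |∑ i, p i * u i - ∑ i, p i * v i| ≤ ε := by
  rw [← Finset.sum_sub_distrib]
  calc |∑ i, (p i * u i - p i * v i)| ≤ ∑ i, |p i * u i - p i * v i| :=
        Finset.abs_sum_le_sum_abs _ _
    _ ≤ ∑ i, p i * ε := by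
        refine Finset.sum_le_sum fun i _ => ?_
        rw [← mul_sub, abs_mul, abs_of_nonneg (hp i)]
        rcases (hp i).eq_or_lt with h0 | h0
        · simp [← h0]
        · exact mul_le_mul_of_nonneg_left (h i h0) h0.le
    _ = ε := by rw [← Finset.sum_mul, hsum, one_mul]

lemma abs_max_sub_max_left_le {x y z ε : ℝ} (h : |y - z| ≤ ε) :
    |max x y - max x z| ≤ ε := by
  rw [max_comm x y, max_comm x z]
  exact (abs_max_sub_max_le_abs y z x).trans h

lemma Finset.abs_sup'_sub_sup'_le {ι : Type*} {s : Finset ι} (hs : s.Nonempty) {f g : ι → ℝ}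
    {ε : ℝ} (h : ∀ i ∈ s, |f i - g i| ≤ ε) : |s.sup' hs f - s.sup' hs g| ≤ ε := by
  rw [abs_sub_le_iff, sub_le_iff_le_add, sub_le_iff_le_add]
  constructor <;> refine Finset.sup'_le hs _ fun i hi => ?_
  · linarith [(abs_sub_le_iff.mp (h i hi)).1, Finset.le_sup' g hi]
  · linarith [(abs_sub_le_iff.mp (h i hi)).2, Finset.le_sup' f hi]

/-- Replacing a supremum of a Lipschitz function by the maximum of an approximation over a
finite `δ`-net. -/
lemma abs_iSup_sub_sup'_le {X : Type*} [PseudoMetricSpace X] {s : Finset X} (hs : s.Nonempty)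
    {δ : ℝ} (hδ : ∀ x, ∃ y ∈ s, dist x y ≤ δ) {f g : X → ℝ} {K ε : ℝ} (hK : 0 ≤ K)
    (hf : ∀ x y, |f x - f y| ≤ K * dist x y) (h : ∀ y ∈ s, |f y - g y| ≤ ε) :
    |(⨆ x, f x) - s.sup' hs g| ≤ δ * K + ε := by
  have : Nonempty X := ⟨hs.choose⟩
  have hδ0 : 0 ≤ δ := by
    obtain ⟨y, -, hy⟩ := hδ hs.choose
    exact dist_nonneg.trans hy
  have hle : ∀ x, f x ≤ δ * K + ε + s.sup' hs g := fun x => by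
    obtain ⟨y, hys, hy⟩ := hδ x
    linarith [(abs_sub_le_iff.mp (hf x y)).1, mul_le_mul_of_nonneg_left hy hK,
      (abs_sub_le_iff.mp (h y hys)).1, Finset.le_sup' g hys]
  have hbdd : BddAbove (Set.range f) := ⟨_, Set.forall_mem_range.mpr hle⟩
  rw [abs_sub_le_iff, sub_le_iff_le_add, sub_le_iff_le_add]
  refine ⟨ciSup_le hle, Finset.sup'_le hs _ fun y hy => ?_⟩
  linarith [(abs_sub_le_iff.mp (h y hy)).2, le_ciSup hbdd y, mul_nonneg hδ0 hK]

/-- Total approximation error bound for an arbitrary belief state: under the hypotheses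
of the total approximation error theorem, with the projected estimator
`Ṽ^h_t(b) := V̂^h_t(Proj_B(b))`, for every `t = 0,…,H` and every `b ∈ Δ_M`:
`|V*_t(b) − Ṽ^h_t(b)| ≤ δ_A·Σ_{s=t}^{H−1} K_s + δ_B·Σ_{s=t}^{H} L^h_s`. -/
theorem total_approximation_error_arbitrary
    (d M : ℕ) (hd : 0 < d) [NeZero M]
    (O : Type) [Fintype O] [Nonempty O]
    (Θ : Type) [MetricSpace Θ]
    (ρ : Fin M → Matrix (Fin d) (Fin d) ℂ)
    (hρpsd : ∀ i, (ρ i).PosSemidef) (hρtr : ∀ i, (ρ i).trace = 1)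
    (E : Θ → O → Matrix (Fin d) (Fin d) ℂ)
    (hEpsd : ∀ θ o, (E θ o).PosSemidef) (hEsum : ∀ θ, ∑ o, E θ o = 1)
    (H : ℕ) (c : ℝ)
    (Θh : Finset Θ) (hΘh : Θh.Nonempty)
    (δA : ℝ) (hδA : ∀ θ : Θ, ∃ θb ∈ Θh, dist θ θb ≤ δA)
    (B : Finset (Fin M → ℝ)) (hBne : B.Nonempty) (hBsub : ∀ x ∈ B, x ∈ simplex M)
    (proj : (Fin M → ℝ) → (Fin M → ℝ)) (hproj : ∀ x ∈ simplex M, proj x ∈ B)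
    (δB : ℝ) (hδB : ∀ x ∈ simplex M, ‖x - proj x‖ ≤ δB)
    (Vstar : ℕ → (Fin M → ℝ) → ℝ)
    (hVstarH : ∀ b ∈ simplex M, Vstar H b = stopVal b)
    (hVstarRec : ∀ t < H, ∀ b ∈ simplex M,
      Vstar t b = max (stopVal b) (⨆ θ : Θ, contG E ρ c b θ (Vstar (t + 1))))
    (Vh : ℕ → (Fin M → ℝ) → ℝ)
    (hVhH : ∀ b ∈ simplex M, Vh H b = stopVal b)
    (hVhRec : ∀ t < H, ∀ b ∈ simplex M,
      Vh t b = max (stopVal b) (Θh.sup' hΘh fun θb => contG E ρ c b θb (Vh (t + 1))))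
    (Vhath : ℕ → (Fin M → ℝ) → ℝ)
    (hVhathH : ∀ b ∈ B, Vhath H b = stopVal b)
    (hVhathRec : ∀ t < H, ∀ b ∈ B,
      Vhath t b = max (stopVal b)
        (Θh.sup' hΘh fun θb =>
          -c + ∑ o, obsProb E ρ o b θb * Vhath (t + 1) (proj (bayes E ρ b θb o))))
    (K : ℕ → ℝ) (hK0 : ∀ t, 0 ≤ K t)
    (hKLip : ∀ t < H, ∀ b ∈ simplex M, ∀ θ θ' : Θ,
      |contG E ρ c b θ (Vstar (t + 1)) - contG E ρ c b θ' (Vstar (t + 1))|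
        ≤ K t * dist θ θ')
    (Lh : ℕ → ℝ) (hLh0 : ∀ s, 0 ≤ Lh s)
    (hLhLip : ∀ s ≤ H, ∀ b ∈ simplex M, ∀ b' ∈ simplex M,
      |Vh s b - Vh s b'| ≤ Lh s * ‖b - b'‖) :
    ∀ t ≤ H, ∀ b ∈ simplex M,
      |Vstar t b - Vhath t (proj b)|
        ≤ δA * ∑ s ∈ Finset.Ico t H, K s + δB * ∑ s ∈ Finset.Icc t H, Lh s := by
  have hexp : ∀ b ∈ simplex M, ∀ θ : Θ, ∀ (u v : O → ℝ) (ε : ℝ),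
      (∀ o, bayes E ρ b θ o ∈ simplex M → |u o - v o| ≤ ε) →
      |(-c + ∑ o, obsProb E ρ o b θ * u o) - (-c + ∑ o, obsProb E ρ o b θ * v o)| ≤ ε := by
    intro b hb θ u v ε h
    rw [add_sub_add_left_eq_sub]
    exact abs_sum_mul_sub_sum_mul_le (obsProb_nonneg (hEpsd θ) hρpsd hb)
      (sum_obsProb (hEsum θ) hρtr hb)
      fun o ho => h o (bayes_mem_simplex (hEpsd θ) hρpsd hb ho)
  have hlibrary : ∀ t ≤ H, ∀ b ∈ simplex M,
      |Vstar t b - Vh t b| ≤ δA * ∑ s ∈ Finset.Ico t H, K s := by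
    intro t ht
    induction ht using Nat.decreasingInduction with
    | self => intro b hb; simp [hVstarH b hb, hVhH b hb]
    | of_succ t ht ih =>
      intro b hb
      rw [hVstarRec t ht b hb, hVhRec t ht b hb, Finset.sum_eq_sum_Ico_succ_bot ht, mul_add]
      exact abs_max_sub_max_left_le <| abs_iSup_sub_sup'_le hΘh hδA (hK0 t)
        (hKLip t ht b hb) fun θ _ => hexp b hb θ _ _ _ fun o ho => ih _ ho
  have hgrid : ∀ t ≤ H, ∀ b ∈ simplex M,
      |Vh t b - Vhath t (proj b)| ≤ δB * ∑ s ∈ Finset.Icc t H, Lh s := by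
    have hprojL : ∀ t ≤ H, ∀ b ∈ simplex M, |Vh t b - Vh t (proj b)| ≤ δB * Lh t :=
      fun t ht b hb => by
        rw [mul_comm]
        exact (hLhLip t ht b hb _ (hBsub _ (hproj b hb))).trans
          (mul_le_mul_of_nonneg_left (hδB b hb) (hLh0 t))
    intro t ht
    induction ht using Nat.decreasingInduction with
    | self =>
      intro b hb
      have hpb := hproj b hb
      rw [hVhathH _ hpb, ← hVhH _ (hBsub _ hpb)]
      simpa using hprojL H le_rfl b hb
    | of_succ t ht ih =>
      intro b hb
      have hpb := hproj b hb
      rw [← Finset.insert_Icc_add_one_left_eq_Icc ht.le, Finset.sum_insert (by simp), mul_add]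
      refine (abs_sub_le _ (Vh t (proj b)) _).trans (add_le_add (hprojL t ht.le b hb) ?_)
      rw [hVhRec t ht _ (hBsub _ hpb), hVhathRec t ht _ hpb]
      exact abs_max_sub_max_left_le <| Finset.abs_sup'_sub_sup'_le hΘh fun θ _ =>
        hexp _ (hBsub _ hpb) θ _ _ _ fun o ho => ih _ ho
  exact fun t ht b hb => (abs_sub_le _ (Vh t b) _).trans
    (add_le_add (hlibrary t ht b hb) (hgrid t ht b hb))
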